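/- arXiv:0905.2149 — 6 statements merged into one kernel-verified Lean document; each statement's English description precedes it below -/
import Mathlib

section
/- Let n be a positive integer and F a field which is of characteristic 0 or of characteristic p ≥ n. If x and y are nilpotent n×n matrices over F that commute with each other, then exp(x + y) = exp(x) · exp(y), where exp denotes the truncated exponential. -/
/-- The truncated exponential of an `n × n` matrix: `exp x = ∑_{i<n} x^i / i!`. -/
noncomputable def truncExp (n : ℕ) {F : Type*} [Field F]
    (x : Matrix (Fin n) (Fin n) F) : Matrix (Fin n) (Fin n) F :=
  ∑ i ∈ Finset.range n, ((Nat.factorial i : F)⁻¹) • x ^ i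

/-- Multiplying a nonzero endomorphism by a nilpotent one commuting with it lowers the rank. -/
theorem finrank_range_mul_lt_of_isNilpotent {F V : Type*} [Field F] [AddCommGroup V] [Module F V]
    [FiniteDimensional F V] {z w : Module.End F V} (hz : IsNilpotent z) (h : Commute z w)
    (hw : w ≠ 0) :
    Module.finrank F (LinearMap.range (z * w)) < Module.finrank F (LinearMap.range w) := by
  apply Submodule.finrank_lt_finrank_of_lt
  refine lt_of_le_of_ne ?_ fun heq => hw ?_
  · rw [h.eq]
    exact LinearMap.range_comp_le_range z w
  · have hmap : (LinearMap.range w).map z = LinearMap.range w := by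
      rw [← LinearMap.range_comp]
      exact heq
    have hpow (k : ℕ) : (LinearMap.range w).map (z ^ k) = LinearMap.range w := by
      induction k with
      | zero => exact Submodule.map_id _
      | succ k ih =>
        rw [pow_succ, Module.End.mul_eq_comp, Submodule.map_comp, hmap, ih]
    obtain ⟨k, hk⟩ := hz
    have hbot := hpow k
    rw [hk, Submodule.map_zero] at hbot
    exact LinearMap.range_eq_bot.mp hbot.symm

/-- A monomial of total degree at least the dimension in two commuting nilpotent endomorphisms
vanishes. -/
theorem pow_mul_pow_eq_zero_of_finrank_le {F V : Type*} [Field F] [AddCommGroup V] [Module F V]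
    [FiniteDimensional F V] {f g : Module.End F V} (hf : IsNilpotent f) (hg : IsNilpotent g)
    (h : Commute f g) {i j : ℕ} (hij : Module.finrank F V ≤ i + j) : f ^ i * g ^ j = 0 := by
  have key : f ^ i * g ^ j ≠ 0 →
      Module.finrank F (LinearMap.range (f ^ i * g ^ j)) + (i + j) ≤ Module.finrank F V := by
    clear hij
    induction i with
    | zero =>
      rw [pow_zero, one_mul]
      induction j with
      | zero => intro _; simpa using Submodule.finrank_le _
      | succ j ih =>
        intro hne
        rw [pow_succ'] at hne ⊢
        have hw := right_ne_zero_of_mul hne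
        have := finrank_range_mul_lt_of_isNilpotent hg ((Commute.refl g).pow_right j) hw
        have := ih hw
        omega
    | succ i ih =>
      intro hne
      rw [pow_succ', mul_assoc] at hne ⊢
      have hw := right_ne_zero_of_mul hne
      have := finrank_range_mul_lt_of_isNilpotent hf
        (((Commute.refl f).pow_right i).mul_right (h.pow_right j)) hw
      have := ih hw
      omega
  by_contra hne
  have hrank : Module.finrank F (LinearMap.range (f ^ i * g ^ j)) = 0 := by
    have := key hne
    omega
  exact hne (LinearMap.range_eq_bot.mp (Submodule.finrank_eq_zero.mp hrank))

/-- A monomial of total degree at least `n` in two commuting nilpotent `n × n` matrices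
vanishes. -/
theorem Matrix.pow_mul_pow_eq_zero_of_le {F : Type*} [Field F] {n : ℕ}
    {x y : Matrix (Fin n) (Fin n) F} (hx : IsNilpotent x) (hy : IsNilpotent y) (hxy : Commute x y)
    {i j : ℕ} (hij : n ≤ i + j) : x ^ i * y ^ j = 0 := by
  have h := pow_mul_pow_eq_zero_of_finrank_le (hx.map Matrix.toLinAlgEquiv')
    (hy.map Matrix.toLinAlgEquiv') (hxy.map Matrix.toLinAlgEquiv') (i := i) (j := j) (by simpa)
  rw [← map_pow, ← map_pow, ← map_mul] at h
  exact (map_eq_zero_iff _ Matrix.toLinAlgEquiv'.injective).mp h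

/-- The factorial of `i < n` is nonzero in a field of characteristic `0` or at least `n`. -/
theorem cast_factorial_ne_zero_of_lt {F : Type*} [Field F] {n i : ℕ}
    (hchar : ringChar F = 0 ∨ n ≤ ringChar F) (hi : i < n) : (Nat.factorial i : F) ≠ 0 := by
  rw [Ne, ringChar.spec]
  intro hdvd
  rcases CharP.char_is_prime_or_zero F (ringChar F) with hp | h0
  · have := hp.dvd_factorial.mp hdvd
    have := hp.pos
    omega
  · rw [h0, zero_dvd_iff] at hdvd
    exact Nat.factorial_ne_zero i hdvd

/-- If `x, y` are commuting nilpotent `n × n` matrices over a field of characteristic `0` or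
`p ≥ n`, then `exp (x + y) = exp x * exp y` for the truncated exponential. -/
theorem truncExp_add (n : ℕ) (hn : 0 < n) (F : Type*) [Field F]
    (hchar : ringChar F = 0 ∨ n ≤ ringChar F)
    (x y : Matrix (Fin n) (Fin n) F)
    (hx : IsNilpotent x) (hy : IsNilpotent y) (hxy : Commute x y) :
    truncExp n (x + y) = truncExp n x * truncExp n y := by
  have hterm : ∀ m ∈ Finset.range n, ((Nat.factorial m : F)⁻¹) • (x + y) ^ m =
      ∑ k ∈ Finset.range (m + 1), ((Nat.factorial k : F)⁻¹ * (Nat.factorial (m - k) : F)⁻¹) •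
        (x ^ k * y ^ (m - k)) := by
    intro m hm
    rw [hxy.add_pow, Finset.smul_sum]
    refine Finset.sum_congr rfl fun k hk => ?_
    have hm' := Finset.mem_range.mp hm
    have hkm : k ≤ m := Nat.lt_succ_iff.mp (Finset.mem_range.mp hk)
    have h0 := cast_factorial_ne_zero_of_lt hchar hm'
    have h1 := cast_factorial_ne_zero_of_lt hchar (hkm.trans_lt hm')
    have h2 := cast_factorial_ne_zero_of_lt hchar ((Nat.sub_le m k).trans_lt hm')
    have hch : (m.choose k : F) * Nat.factorial k * Nat.factorial (m - k) = Nat.factorial m := by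
      rw [← Nat.choose_mul_factorial_mul_factorial hkm]
      push_cast
      rfl
    rw [← nsmul_eq_mul', ← Nat.cast_smul_eq_nsmul F, smul_smul]
    congr 1
    field_simp
    linear_combination hch
  unfold truncExp
  rw [Finset.sum_congr rfl hterm, Finset.sum_range_diag_flip n fun i j =>
    ((Nat.factorial i : F)⁻¹ * (Nat.factorial j : F)⁻¹) • (x ^ i * y ^ j), Finset.sum_mul_sum]
  refine Finset.sum_congr rfl fun i _ => ?_
  simp only [smul_mul_smul_comm]
  refine Finset.sum_subset (Finset.range_mono (Nat.sub_le n i)) fun j _ hj => ?_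
  rw [Matrix.pow_mul_pow_eq_zero_of_le hx hy hxy, smul_zero]
  rw [Finset.mem_range] at hj
  omega
end

section
/- Let n be a positive integer and F a field which is of characteristic 0 or of characteristic p ≥ n. For every nilpotent n×n matrix x over F, log(exp(x)) = x, where exp and log denote the truncated exponential and logarithm. -/
/-- The truncated logarithm of an `n × n` matrix: `log u = -∑_{i=1}^{n-1} (1-u)^i / i`. -/
noncomputable def truncLog (n : ℕ) {F : Type*} [Field F]
    (u : Matrix (Fin n) (Fin n) F) : Matrix (Fin n) (Fin n) F :=
  -∑ i ∈ Finset.Icc 1 (n - 1), ((i : F)⁻¹) • (1 - u) ^ i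

open Polynomial in
/-- Over a field in which `1, …, m` are invertible, a polynomial without constant term whose
derivative is divisible by `X ^ m` is divisible by `X ^ (m + 1)`. -/
theorem X_pow_succ_dvd_of_X_pow_dvd_derivative {F : Type*} [Field F] {m : ℕ}
    (hm : ∀ k < m, ((k + 1 : ℕ) : F) ≠ 0) {p : F[X]} (h0 : p.coeff 0 = 0)
    (hp : X ^ m ∣ derivative p) : X ^ (m + 1) ∣ p := by
  rw [X_pow_dvd_iff] at hp ⊢
  rintro (_ | k) hk
  · exact h0
  · have h := hp k (by omega)
    rw [coeff_derivative] at h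
    exact (mul_eq_zero.mp h).resolve_right (by exact_mod_cast hm k (by omega))

open Polynomial in
/-- The truncated exponential polynomial `∑_{i ≤ m} X ^ i / i!`. -/
noncomputable def truncExpPoly (F : Type*) [Field F] (m : ℕ) : F[X] :=
  ∑ i ∈ Finset.range (m + 1), C ((Nat.factorial i : F)⁻¹) * X ^ i

open Polynomial in
/-- The truncated logarithm of the truncated exponential polynomial,
`-∑_{1 ≤ i ≤ m} (1 - truncExpPoly F m) ^ i / i`. -/
noncomputable def truncLogExpPoly (F : Type*) [Field F] (m : ℕ) : F[X] :=
  -∑ i ∈ Finset.range m, C (((i + 1 : ℕ) : F)⁻¹) * (1 - truncExpPoly F m) ^ (i + 1)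

open Polynomial in
theorem X_dvd_one_sub_truncExpPoly (F : Type*) [Field F] (m : ℕ) :
    X ∣ 1 - truncExpPoly F m := by
  rw [X_dvd_iff, truncExpPoly, Finset.sum_range_succ']
  simp [coeff_X_pow]

open Polynomial in
theorem derivative_truncExpPoly {F : Type*} [Field F] {m : ℕ}
    (hm : ∀ k < m, ((k + 1 : ℕ) : F) ≠ 0) :
    derivative (truncExpPoly F m) =
      truncExpPoly F m - C ((Nat.factorial m : F)⁻¹) * X ^ m := by
  have h : derivative (truncExpPoly F m) =
      ∑ i ∈ Finset.range m, C ((Nat.factorial i : F)⁻¹) * X ^ i := by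
    rw [truncExpPoly, Finset.sum_range_succ', derivative_add, derivative_sum]
    simp only [pow_zero, mul_one, derivative_C, add_zero]
    refine Finset.sum_congr rfl fun i hi => ?_
    have hne := hm i (Finset.mem_range.mp hi)
    rw [derivative_C_mul_X_pow, Nat.factorial_succ, Nat.add_sub_cancel, Nat.cast_mul, mul_inv,
      mul_right_comm, inv_mul_cancel₀ hne, one_mul]
  rw [h, truncExpPoly, Finset.sum_range_succ, add_sub_cancel_right]

open Polynomial in
theorem derivative_truncLogExpPoly {F : Type*} [Field F] {m : ℕ}
    (hm : ∀ k < m, ((k + 1 : ℕ) : F) ≠ 0) :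
    derivative (truncLogExpPoly F m) =
      derivative (truncExpPoly F m) * ∑ i ∈ Finset.range m, (1 - truncExpPoly F m) ^ i := by
  rw [truncLogExpPoly, derivative_neg, derivative_sum, Finset.mul_sum, ← Finset.sum_neg_distrib]
  refine Finset.sum_congr rfl fun i hi => ?_
  have hC : C (((i + 1 : ℕ) : F)⁻¹) * C ((i + 1 : ℕ) : F) = 1 := by
    rw [← C_mul, inv_mul_cancel₀ (hm i (Finset.mem_range.mp hi)), C_1]
  rw [derivative_C_mul, derivative_pow, Nat.add_sub_cancel, derivative_sub, derivative_one]
  linear_combination (derivative (truncExpPoly F m) * (1 - truncExpPoly F m) ^ i) * hC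

open Polynomial in
theorem X_pow_dvd_truncLogExpPoly_sub_X {F : Type*} [Field F] {m : ℕ}
    (hm : ∀ k < m, ((k + 1 : ℕ) : F) ≠ 0) :
    X ^ (m + 1) ∣ truncLogExpPoly F m - X := by
  have hX := X_dvd_one_sub_truncExpPoly F m
  refine X_pow_succ_dvd_of_X_pow_dvd_derivative hm ?_ ?_
  · rw [← X_dvd_iff]
    refine dvd_sub ((Finset.dvd_sum fun i _ => ?_).neg_right) dvd_rfl
    exact (hX.trans (dvd_pow_self _ i.succ_ne_zero)).mul_left _
  · have hgeom := mul_neg_geom_sum (1 - truncExpPoly F m) m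
    have h : derivative (truncLogExpPoly F m - X) =
        -(1 - truncExpPoly F m) ^ m - X ^ m * (C ((Nat.factorial m : F)⁻¹) *
          ∑ i ∈ Finset.range m, (1 - truncExpPoly F m) ^ i) := by
      rw [derivative_sub, derivative_X, derivative_truncLogExpPoly hm, derivative_truncExpPoly hm]
      linear_combination hgeom
    rw [h]
    exact dvd_sub (pow_dvd_pow_of_dvd hX m).neg_right (dvd_mul_right _ _)

theorem aeval_truncExpPoly {F : Type*} [Field F] {m : ℕ}
    (x : Matrix (Fin (m + 1)) (Fin (m + 1)) F) :
    Polynomial.aeval x (truncExpPoly F m) = truncExp (m + 1) x := by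
  simp [truncExpPoly, truncExp, Algebra.smul_def]

theorem aeval_truncLogExpPoly {F : Type*} [Field F] {m : ℕ}
    (x : Matrix (Fin (m + 1)) (Fin (m + 1)) F) :
    Polynomial.aeval x (truncLogExpPoly F m) = truncLog (m + 1) (truncExp (m + 1) x) := by
  rw [truncLog, Nat.add_sub_cancel, ← Finset.Ico_add_one_right_eq_Icc,
    Finset.sum_Ico_eq_sum_range, Nat.add_sub_cancel, truncLogExpPoly, map_neg, map_sum]
  refine congrArg _ (Finset.sum_congr rfl fun i _ => ?_)
  rw [map_mul, Polynomial.aeval_C, map_pow, map_sub, map_one, aeval_truncExpPoly,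
    ← Algebra.smul_def, add_comm 1 i]

theorem natCast_ne_zero_of_lt_ringChar {F : Type*} [Field F] {n k : ℕ}
    (hchar : ringChar F = 0 ∨ n ≤ ringChar F) (hk : k ≠ 0) (hkn : k < n) : (k : F) ≠ 0 := by
  rw [Ne, ringChar.spec]
  intro hdvd
  rcases hchar with h | h
  · exact hk (Nat.eq_zero_of_zero_dvd (h ▸ hdvd))
  · exact absurd (Nat.le_of_dvd (Nat.pos_of_ne_zero hk) hdvd) (by omega)

theorem Matrix.pow_card_eq_zero_of_isNilpotent {F : Type*} [Field F] {n : ℕ}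
    {x : Matrix (Fin n) (Fin n) F} (hx : IsNilpotent x) : x ^ n = 0 := by
  have h := Matrix.isNilpotent_charpoly_sub_pow_of_isNilpotent hx
  have hchi := x.aeval_self_charpoly
  rw [sub_eq_zero.mp h.eq_zero] at hchi
  simpa using hchi

/-- For a nilpotent `n × n` matrix `x` over a field of characteristic `0` or `p ≥ n`,
`log (exp x) = x`. -/
theorem truncLog_truncExp (n : ℕ) (hn : 0 < n) (F : Type*) [Field F]
    (hchar : ringChar F = 0 ∨ n ≤ ringChar F)
    (x : Matrix (Fin n) (Fin n) F) (hx : IsNilpotent x) :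
    truncLog n (truncExp n x) = x := by
  obtain ⟨m, rfl⟩ := Nat.exists_eq_succ_of_ne_zero hn.ne'
  have hm : ∀ k < m, ((k + 1 : ℕ) : F) ≠ 0 := fun k hk =>
    natCast_ne_zero_of_lt_ringChar hchar k.succ_ne_zero (by omega)
  obtain ⟨q, hq⟩ := X_pow_dvd_truncLogExpPoly_sub_X hm
  have h := congrArg (Polynomial.aeval x) hq
  rw [map_sub, map_mul, map_pow, Polynomial.aeval_X, aeval_truncLogExpPoly,
    Matrix.pow_card_eq_zero_of_isNilpotent hx, zero_mul] at h
  exact sub_eq_zero.mp h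
end

section
/- Let p be a prime and n a positive integer with p ≥ n. Let Γ be a subgroup of GL_n(F_p), and let Γ⁺ denote the subgroup of Γ generated by all elements of Γ of order p. Then Γ⁺ is a normal subgroup of Γ, and the index [Γ : Γ⁺] is prime to p. -/
/-- A nilpotent square matrix over a reduced ring is killed by its size. -/
theorem Matrix.pow_card_eq_zero_of_isNilpotent_s7 {m R : Type*} [Fintype m] [DecidableEq m]
    [CommRing R] [IsReduced R] {M : Matrix m m R} (hM : IsNilpotent M) :
    M ^ Fintype.card m = 0 := by
  have h : M.charpoly = Polynomial.X ^ Fintype.card m :=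
    sub_eq_zero.mp <| Polynomial.ext fun i => (Polynomial.isNilpotent_iff.mp
      (Matrix.isNilpotent_charpoly_sub_pow_of_isNilpotent hM) i).eq_zero
  simpa [h] using M.aeval_self_charpoly

/-- In characteristic `p`, a matrix of size at most `p` whose order is a power of `p` satisfies
`M ^ p = 1`. -/
theorem Matrix.pow_char_eq_one_of_pow_char_pow_eq_one {m R : Type*} [Fintype m] [DecidableEq m]
    [Nonempty m] [CommRing R] [IsReduced R] (p : ℕ) [Fact p.Prime] [CharP R p]
    (hp : Fintype.card m ≤ p) {M : Matrix m m R} {k : ℕ} (hM : M ^ p ^ k = 1) :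
    M ^ p = 1 := by
  have hnil : IsNilpotent (M - 1) :=
    ⟨p ^ k, by rw [sub_pow_char_pow_of_commute _ _ (Commute.one_right M), hM, one_pow, sub_self]⟩
  have hzero : (M - 1) ^ p = 0 :=
    pow_eq_zero_of_le hp (Matrix.pow_card_eq_zero_of_isNilpotent_s7 hnil)
  rwa [sub_pow_char_of_commute _ (Commute.one_right M), one_pow, sub_eq_zero] at hzero

/-- The elements `g ≠ 1` with `g ^ n = 1` generate a normal subgroup. -/
theorem Subgroup.normal_closure_pow_eq_one {G : Type*} [Group G] (n : ℕ) :
    (Subgroup.closure {g : G | g ^ n = 1 ∧ g ≠ 1}).Normal := by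
  have h : Group.conjugatesOfSet {g : G | g ^ n = 1 ∧ g ≠ 1} = {g : G | g ^ n = 1 ∧ g ≠ 1} := by
    refine Set.Subset.antisymm (fun x hx => ?_) Group.subset_conjugatesOfSet
    obtain ⟨a, ⟨ha, ha'⟩, hax⟩ := Group.mem_conjugatesOfSet_iff.mp hx
    obtain ⟨c, rfl⟩ := isConj_iff.mp hax
    exact ⟨by simp [conj_pow, ha], by simpa using ha'⟩
  rw [← h]
  exact Subgroup.normalClosure_normal

/-- Let `p ≥ n` be a prime and `Γ` a subgroup of `GL_n(𝔽_p)`.  The subgroup `Γ⁺` of `Γ`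
generated by the elements of order `p` is normal in `Γ`, of index prime to `p`. -/
theorem gammaPlus_normal_index_coprime (p n : ℕ) [hp : Fact p.Prime] (hn : 0 < n)
    (hpn : n ≤ p) (Γ : Subgroup (GL (Fin n) (ZMod p))) :
    (Subgroup.closure {g : Γ | g ^ p = 1 ∧ g ≠ 1}).Normal ∧
      ¬ p ∣ (Subgroup.closure {g : Γ | g ^ p = 1 ∧ g ≠ 1}).index := by
  refine ⟨Subgroup.normal_closure_pow_eq_one p, fun hdvd => ?_⟩
  have : Nonempty (Fin n) := ⟨⟨0, hn⟩⟩
  let P : Sylow p Γ := default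
  have hP : (P : Subgroup Γ) ≤ Subgroup.closure {g : Γ | g ^ p = 1 ∧ g ≠ 1} := by
    intro g hg
    by_cases hg1 : g = 1
    · rw [hg1]
      exact one_mem _
    refine Subgroup.subset_closure ⟨?_, hg1⟩
    obtain ⟨k, hk⟩ := P.isPGroup' ⟨g, hg⟩
    have hgk : g ^ p ^ k = 1 := congrArg Subtype.val hk
    have hmat : ((g : GL (Fin n) (ZMod p)) : Matrix (Fin n) (Fin n) (ZMod p)) ^ p ^ k = 1 := by
      rw [← Units.val_pow_eq_pow_val, ← Subgroup.coe_pow, hgk]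
      rfl
    have := Matrix.pow_char_eq_one_of_pow_char_pow_eq_one p (by simpa using hpn) hmat
    apply Subtype.ext
    apply Units.ext
    simpa using this
  exact P.not_dvd_index (hdvd.trans (Subgroup.index_dvd_of_le hP))
end

section
/- Let p be an odd prime, n a positive integer, H a subgroup of GL_n(Z_p), and m ≥ 1 an integer. Then L_m(H) ⊆ L_{m+1}(H), where L_m(H) ⊆ M_n(F_p) denotes the set of reductions modulo p of the matrices (h − 1)/p^m as h ranges over the elements of H with h ≡ 1 (mod p^m). -/
/-- For a subgroup `H` of `GL_n(ℤ_p)` and `m ≥ 1`, `L_m(H) ⊆ M_n(𝔽_p)` is the set of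
reductions mod `p` of the matrices `(h - 1)/p^m`, as `h` ranges over the elements of `H`
with `h ≡ 1 (mod p^m)`. -/
def Lm (p n : ℕ) [Fact p.Prime] (m : ℕ) (H : Subgroup (GL (Fin n) ℤ_[p])) :
    Set (Matrix (Fin n) (Fin n) (ZMod p)) :=
  {y | ∃ h ∈ H, ∃ M : Matrix (Fin n) (Fin n) ℤ_[p],
    (h : Matrix (Fin n) (Fin n) ℤ_[p]) - 1 = ((p : ℤ_[p]) ^ m) • M ∧
      M.map (PadicInt.toZMod) = y}

theorem Nat.Prime.pow_add_two_dvd_pow_mul_choose {p : ℕ} (hp : p.Prime) (hodd : p ≠ 2) {m : ℕ}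
    (hm : 1 ≤ m) (k : ℕ) : p ^ (m + 2) ∣ (p ^ m) ^ (k + 2) * p.choose (k + 2) := by
  rw [← pow_mul]
  rcases lt_trichotomy (k + 2) p with h | h | h
  · have h₁ : p ^ (m + 1) ∣ p ^ (m * (k + 2)) := pow_dvd_pow p (by nlinarith)
    simpa only [← pow_succ] using mul_dvd_mul h₁ (hp.dvd_choose_self (by omega) h)
  · have hk : 1 ≤ k := by omega
    exact Dvd.dvd.mul_right (pow_dvd_pow p (by nlinarith)) _
  · simp [Nat.choose_eq_zero_of_lt h]

theorem exists_one_add_prime_pow_mul_pow_eq {R : Type*} [Ring R] {p : ℕ} (hp : p.Prime)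
    (hodd : p ≠ 2) {m : ℕ} (hm : 1 ≤ m) (x : R) :
    ∃ y : R, (1 + (p ^ m : ℕ) * x) ^ p = 1 + (p ^ (m + 1) : ℕ) * (x + p * y) := by
  choose d hd using hp.pow_add_two_dvd_pow_mul_choose hodd hm
  obtain ⟨q, hq⟩ : ∃ q, p = q + 1 := ⟨p - 1, by have := hp.pos; omega⟩
  refine ⟨∑ k ∈ Finset.range q, (d k : R) * x ^ (k + 2), ?_⟩
  have key (k : ℕ) : ((p ^ m : ℕ) * x) ^ (k + 2) * (p.choose (k + 2) : R) =
      (p ^ (m + 1) : ℕ) * (p * ((d k : R) * x ^ (k + 2))) := by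
    rw [(Nat.cast_commute (p ^ m) x).mul_pow, mul_assoc, ← (Nat.cast_commute _ _).eq, ← mul_assoc,
      ← Nat.cast_pow, ← Nat.cast_mul, hd, ← mul_assoc, ← mul_assoc, ← Nat.cast_mul, ← Nat.cast_mul]
    ring_nf
  have hsum : ∑ k ∈ Finset.range q, ((p ^ m : ℕ) * x) ^ (k + 2) * (p.choose (k + 2) : R) =
      (p ^ (m + 1) : ℕ) * (p * ∑ k ∈ Finset.range q, (d k : R) * x ^ (k + 2)) := by
    simp_rw [key, Finset.mul_sum]
  have hexp := (Commute.one_right ((p ^ m : ℕ) * x)).add_pow p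
  have hrange : Finset.range (p + 1) = Finset.range (q + 1 + 1) := by rw [hq]
  rw [hrange, Finset.sum_range_succ', Finset.sum_range_succ'] at hexp
  simp only [one_pow, mul_one, add_assoc, Nat.reduceAdd, hsum] at hexp
  rw [add_comm, hexp, mul_add]
  simp only [pow_one, Nat.choose_one_right, pow_zero, Nat.choose_zero_right,
    Nat.cast_one, mul_one]
  rw [← (Nat.cast_commute p _).eq, ← mul_assoc (p : R), ← Nat.cast_mul, ← pow_succ']
  abel

/-- For an odd prime `p`, a subgroup `H ≤ GL_n(ℤ_p)` and `m ≥ 1`, one has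
`L_m(H) ⊆ L_{m+1}(H)`. -/
theorem Lm_subset_Lm_succ (p n : ℕ) [hp : Fact p.Prime] (hodd : p ≠ 2) (hn : 0 < n)
    (H : Subgroup (GL (Fin n) ℤ_[p])) (m : ℕ) (hm : 1 ≤ m) :
    Lm p n m H ⊆ Lm p n (m + 1) H := by
  rintro _ ⟨h, hH, M, hM, rfl⟩
  obtain ⟨N, hN⟩ := exists_one_add_prime_pow_mul_pow_eq hp.out hodd hm M
  have hsmul (k : ℕ) (A : Matrix (Fin n) (Fin n) ℤ_[p]) :
      ((p ^ k : ℕ) : Matrix (Fin n) (Fin n) ℤ_[p]) * A = (p : ℤ_[p]) ^ k • A := by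
    rw [← nsmul_eq_mul, ← Nat.cast_smul_eq_nsmul ℤ_[p], Nat.cast_pow]
  have hp_mul : (p : Matrix (Fin n) (Fin n) ℤ_[p]) * N = (p : ℤ_[p]) • N := by
    simpa using hsmul 1 N
  rw [hsmul, hsmul, hp_mul, ← hM, add_sub_cancel] at hN
  refine ⟨h ^ p, H.pow_mem hH p, M + (p : ℤ_[p]) • N, ?_, ?_⟩
  · rw [Units.val_pow_eq_pow_val, hN, add_sub_cancel_left]
  · ext i j
    simp
end

section
/- Let p be a prime, n a positive integer, and let G ⊆ H be closed subgroups of the topological group GL_n(Z_p). If L_m(G) = L_m(H) for every integer m ≥ 1, then F_1 G = F_1 H; that is, every element of H congruent to the identity modulo p lies in G. -/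
open Filter Topology in
/-- A sequence of matrices over `ℤ_[p]` whose `k`-th term is congruent to `1` modulo `p ^ k`
converges to `1`. -/
theorem tendsto_one_of_sub_one_eq_pow_smul {p n : ℕ} [hp : Fact p.Prime]
    {A M : ℕ → Matrix (Fin n) (Fin n) ℤ_[p]}
    (hA : ∀ k, A k - 1 = ((p : ℤ_[p]) ^ k) • M k) : Tendsto A atTop (𝓝 1) := by
  have hsmul : Tendsto (fun k => ((p : ℤ_[p]) ^ k) • M k) atTop (𝓝 0) := by
    refine tendsto_pi_nhds.2 fun i => tendsto_pi_nhds.2 fun j => ?_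
    have hpow : Tendsto (fun k : ℕ => ((p : ℝ)⁻¹) ^ k) atTop (𝓝 0) :=
      tendsto_pow_atTop_nhds_zero_of_lt_one (by positivity)
        (inv_lt_one_of_one_lt₀ (by exact_mod_cast hp.out.one_lt))
    refine squeeze_zero_norm (fun k => ?_) hpow
    rw [Matrix.smul_apply, smul_eq_mul, norm_mul, norm_pow, PadicInt.norm_p]
    exact mul_le_of_le_one_right (by positivity) (PadicInt.norm_le_one _)
  have hadd := hsmul.const_add 1
  rw [add_zero] at hadd
  refine hadd.congr fun k => ?_
  rw [← hA k]
  abel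

open Filter Topology in
/-- A sequence in `GL_n(ℤ_[p])` whose `k`-th term is congruent to `1` modulo `p ^ k`
converges to `1`. -/
theorem tendsto_GL_one_of_sub_one_eq_pow_smul {p n : ℕ} [Fact p.Prime]
    {u : ℕ → GL (Fin n) ℤ_[p]} {M : ℕ → Matrix (Fin n) (Fin n) ℤ_[p]}
    (hu : ∀ k, (u k : Matrix (Fin n) (Fin n) ℤ_[p]) - 1 = ((p : ℤ_[p]) ^ k) • M k) :
    Tendsto u atTop (𝓝 1) := by
  rw [Units.isInducing_embedProduct.tendsto_nhds_iff]
  refine Tendsto.prodMk_nhds (tendsto_one_of_sub_one_eq_pow_smul hu)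
    ((MulOpposite.continuous_op.tendsto _).comp (tendsto_one_of_sub_one_eq_pow_smul
      (M := fun k => -(((u k)⁻¹ : GL (Fin n) ℤ_[p]) * M k)) fun k => ?_))
  rw [smul_neg, ← mul_smul_comm, ← hu k, mul_sub, Units.inv_mul, mul_one, neg_sub]

/-- If two matrices over `ℤ_[p]` have the same reduction mod `p`, then their difference is
divisible by `p`. -/
theorem exists_sub_eq_smul_of_map_toZMod_eq {p n : ℕ} [Fact p.Prime]
    {M N : Matrix (Fin n) (Fin n) ℤ_[p]}
    (h : M.map PadicInt.toZMod = N.map PadicInt.toZMod) :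
    ∃ D : Matrix (Fin n) (Fin n) ℤ_[p], M - N = (p : ℤ_[p]) • D := by
  have hdvd : ∀ i j, (p : ℤ_[p]) ∣ M i j - N i j := fun i j => by
    rw [← Ideal.mem_span_singleton, ← PadicInt.maximalIdeal_eq_span_p, ← PadicInt.ker_toZMod,
      RingHom.mem_ker, map_sub, sub_eq_zero]
    exact congrFun (congrFun h i) j
  choose D hD using hdvd
  exact ⟨D, by ext i j; exact hD i j⟩

/-- If `L_m(H) ⊆ L_m(G)` for all `m ≥ 1`, then every element of `H` congruent to `1` modulo `p`
agrees with elements of `G` modulo arbitrarily high powers of `p`. -/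
theorem exists_inv_mul_sub_one_eq_pow_smul {p n : ℕ} [Fact p.Prime]
    {G H : Subgroup (GL (Fin n) ℤ_[p])} (hGH : G ≤ H)
    (hL : ∀ m : ℕ, 1 ≤ m → Lm p n m H ⊆ Lm p n m G) {h : GL (Fin n) ℤ_[p]} (hh : h ∈ H)
    (h1 : ∀ i j : Fin n, (p : ℤ_[p]) ∣ ((h : Matrix (Fin n) (Fin n) ℤ_[p]) - 1) i j) (k : ℕ) :
    ∃ g ∈ G, ∃ M : Matrix (Fin n) (Fin n) ℤ_[p],
      ((g⁻¹ * h : GL (Fin n) ℤ_[p]) : Matrix (Fin n) (Fin n) ℤ_[p]) - 1 =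
        ((p : ℤ_[p]) ^ (k + 1)) • M := by
  induction k with
  | zero =>
    choose M hM using h1
    refine ⟨1, G.one_mem, M, ?_⟩
    ext i j
    rw [zero_add, pow_one, inv_one, one_mul]
    exact hM i j
  | succ k ih =>
    obtain ⟨g, hg, M, hM⟩ := ih
    obtain ⟨g', hg', N, hN, hNM⟩ := hL (k + 1) (Nat.le_add_left 1 k)
      ⟨g⁻¹ * h, H.mul_mem (H.inv_mem (hGH hg)) hh, M, hM, rfl⟩
    obtain ⟨D, hD⟩ := exists_sub_eq_smul_of_map_toZMod_eq hNM.symm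
    refine ⟨g * g', G.mul_mem hg hg', (g'⁻¹ : GL (Fin n) ℤ_[p]) * D, ?_⟩
    have hdiff : ((g⁻¹ * h : GL (Fin n) ℤ_[p]) : Matrix (Fin n) (Fin n) ℤ_[p]) - g' =
        ((p : ℤ_[p]) ^ (k + 1 + 1)) • D := by
      rw [pow_succ, mul_smul, ← hD, smul_sub, ← hM, ← hN]
      abel
    rw [← mul_smul_comm, ← hdiff, mul_sub, Units.inv_mul, mul_inv_rev, mul_assoc, Units.val_mul]

/-- Let `G ≤ H` be closed subgroups of the topological group `GL_n(ℤ_p)`.  If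
`L_m(G) = L_m(H)` for all `m ≥ 1`, then `F_1 G = F_1 H`: every element of `H` congruent
to `1` modulo `p` lies in `G`. -/
theorem closed_subgroups_eq_of_Lm_eq (p n : ℕ) [hp : Fact p.Prime] (hn : 0 < n)
    (G H : Subgroup (GL (Fin n) ℤ_[p])) (hGH : G ≤ H)
    (hGclosed : IsClosed (G : Set (GL (Fin n) ℤ_[p])))
    (hHclosed : IsClosed (H : Set (GL (Fin n) ℤ_[p])))
    (hL : ∀ m : ℕ, 1 ≤ m → Lm p n m G = Lm p n m H) :
    ∀ h : GL (Fin n) ℤ_[p], h ∈ H →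
      (∀ i j : Fin n, (p : ℤ_[p]) ∣ (((h : Matrix (Fin n) (Fin n) ℤ_[p]) - 1) i j)) →
      h ∈ G := by
  intro h hh h1
  choose g hg M hM using exists_inv_mul_sub_one_eq_pow_smul hGH (fun m hm => (hL m hm).ge) hh h1
  have hlim : Filter.Tendsto (fun k => (g k)⁻¹ * h) Filter.atTop (nhds 1) :=
    tendsto_GL_one_of_sub_one_eq_pow_smul (M := fun k => (p : ℤ_[p]) • M k) fun k => by
      rw [hM k, pow_succ, mul_smul]
  have hg_lim := hlim.inv.const_mul h
  simp only [mul_inv_rev, inv_inv, mul_inv_cancel_left, inv_one, mul_one] at hg_lim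
  exact hGclosed.mem_of_tendsto hg_lim (Filter.Eventually.of_forall hg)
end

section
/- Let p be a prime and n a positive integer with n < p − 1. Then GL_n(Q_p) contains no element of order p; that is, there is no matrix A ∈ GL_n(Q_p) with A^p = 1 and A ≠ 1. -/
open Polynomial in
/-- The shifted `p`-th cyclotomic polynomial is Eisenstein over the `p`-adic integers. -/
theorem PadicInt.taylor_cyclotomic_isEisensteinAt (p : ℕ) [hp : Fact p.Prime] :
    (taylor 1 (cyclotomic p ℤ_[p])).IsEisensteinAt (Ideal.span {(p : ℤ_[p])}) := by
  have hmap : taylor 1 (cyclotomic p ℤ_[p]) =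
      ((cyclotomic p ℤ).comp (X + 1)).map (Int.castRingHom ℤ_[p]) := by
    simp [taylor_apply, Polynomial.map_comp]
  have hprime : (Ideal.span {(p : ℤ_[p])}).IsPrime :=
    (Ideal.span_singleton_prime PadicInt.prime_p.ne_zero).2 PadicInt.prime_p
  have hmonic : (taylor 1 (cyclotomic p ℤ_[p])).Monic :=
    (leadingCoeff_taylor _ _).trans (cyclotomic.monic p ℤ_[p])
  refine hmonic.isEisensteinAt_of_mem_of_notMem hprime.ne_top (fun {i} hi => ?_) ?_
  · have hi' : i < ((cyclotomic p ℤ).comp (X + 1)).natDegree := by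
      rw [hmap] at hi
      exact hi.trans_le natDegree_map_le
    have hmem := (cyclotomic_comp_X_add_one_isEisensteinAt p).mem hi'
    rw [Ideal.submodule_span_eq, Ideal.mem_span_singleton] at hmem
    rw [hmap, coeff_map, Ideal.mem_span_singleton]
    simpa using map_dvd (Int.castRingHom ℤ_[p]) hmem
  · rw [taylor_coeff_zero, eval_one_cyclotomic_prime, Ideal.span_singleton_pow,
      Ideal.mem_span_singleton]
    intro h
    have := (pow_dvd_pow_iff PadicInt.prime_p.ne_zero PadicInt.prime_p.not_isUnit
      (n := 2) (m := 1)).1 (by simpa using h)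
    omega

open Polynomial in
/-- The `p`-th cyclotomic polynomial is irreducible over `ℚ_p`. -/
theorem Padic.irreducible_cyclotomic (p : ℕ) [hp : Fact p.Prime] :
    Irreducible (cyclotomic p ℚ_[p]) := by
  have hprime : (Ideal.span {(p : ℤ_[p])}).IsPrime :=
    (Ideal.span_singleton_prime PadicInt.prime_p.ne_zero).2 PadicInt.prime_p
  have htaylor : Irreducible (taylor 1 (cyclotomic p ℤ_[p])) := by
    refine (PadicInt.taylor_cyclotomic_isEisensteinAt p).irreducible hprime
      (Monic.isPrimitive ((leadingCoeff_taylor _ _).trans (cyclotomic.monic p ℤ_[p]))) ?_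
    rw [natDegree_taylor, natDegree_cyclotomic]
    exact Nat.totient_pos.2 hp.out.pos
  have hint : Irreducible (cyclotomic p ℤ_[p]) :=
    (MulEquiv.irreducible_iff (taylorEquiv (1 : ℤ_[p]))).1 htaylor
  rw [(cyclotomic.monic p ℤ_[p]).irreducible_iff_irreducible_map_fraction_map (K := ℚ_[p]),
    map_cyclotomic] at hint
  exact hint

open Polynomial in
/-- A matrix of size less than `p - 1` over a field where the `p`-th cyclotomic polynomial is
irreducible is trivial as soon as its `p`-th power is. -/
theorem Matrix.eq_one_of_pow_prime_eq_one {K ι : Type*} [Field K] [Fintype ι] [DecidableEq ι]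
    {p : ℕ} [hp : Fact p.Prime] (hirr : Irreducible (cyclotomic p K))
    (hcard : Fintype.card ι < p - 1) {A : Matrix ι ι K} (hA : A ^ p = 1) : A = 1 := by
  have hndvd : ¬ cyclotomic p K ∣ A.charpoly := fun h => by
    have := natDegree_le_of_dvd h A.charpoly_monic.ne_zero
    rw [natDegree_cyclotomic, Nat.totient_prime hp.out, A.charpoly_natDegree_eq_dim] at this
    omega
  obtain ⟨a, b, hab⟩ := (hirr.coprime_iff_not_dvd).2 hndvd
  have hinv : aeval A a * aeval A (cyclotomic p K) = 1 := by
    simpa [Matrix.aeval_self_charpoly] using congrArg (aeval A) hab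
  have hzero : aeval A (cyclotomic p K) * (A - 1) = 0 := by
    simpa [hA] using congrArg (aeval A) (cyclotomic_prime_mul_X_sub_one K p)
  rw [← sub_eq_zero]
  calc A - 1 = aeval A a * aeval A (cyclotomic p K) * (A - 1) := by rw [hinv, one_mul]
    _ = 0 := by rw [mul_assoc, hzero, mul_zero]

/-- For a prime `p` and `n < p - 1`, the group `GL_n(ℚ_p)` contains no element of
order `p`: there is no `A ∈ GL_n(ℚ_p)` with `A^p = 1` and `A ≠ 1`. -/
theorem no_p_torsion_in_GLn_Qp (p n : ℕ) [hp : Fact p.Prime] (hn : 0 < n)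
    (hnp : n < p - 1) :
    ¬ ∃ A : GL (Fin n) ℚ_[p], A ^ p = 1 ∧ A ≠ 1 := by
  rintro ⟨A, hA, hne⟩
  refine hne (Units.ext ?_)
  refine Matrix.eq_one_of_pow_prime_eq_one (Padic.irreducible_cyclotomic p) (by simpa using hnp) ?_
  rw [← Units.val_pow_eq_pow_val, hA, Units.val_one]
end
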